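/- Let Λ₁, Λ₂: ℝ → ℝ be real analytic, positive, 1-periodic functions with Λ₁ nonconstant, and let Λ, u₀, f, g be the real analytic solution of system (11) on ℝ² × (−ε, ε), doubly periodic in (x,y), with the Liouville initial data. Then for every fixed t ∈ (−ε, ε), the functions (x,y) ↦ Λ(x,y,t), u₀(x,y,t), f(x,y,t), g(x,y,t) satisfy system (9); that is, the flow of system (11) preserves the set of solutions of system (9). -/

import Mathlib

open Set

/-- Partial derivative in `x`. -/
noncomputable def pX (h : ℝ × ℝ × ℝ → ℝ) (p : ℝ × ℝ × ℝ) : ℝ := fderiv ℝ h p (1, 0, 0)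

/-- Partial derivative in `y`. -/
noncomputable def pY (h : ℝ × ℝ × ℝ → ℝ) (p : ℝ × ℝ × ℝ) : ℝ := fderiv ℝ h p (0, 1, 0)

/-- Partial derivative in `t`. -/
noncomputable def pT (h : ℝ × ℝ × ℝ → ℝ) (p : ℝ × ℝ × ℝ) : ℝ := fderiv ℝ h p (0, 0, 1)

/-- The strip `ℝ² × (-ε, ε)` in coordinates `(x, y, t)`. -/
def Strip (ε : ℝ) : Set (ℝ × ℝ × ℝ) := {p : ℝ × ℝ × ℝ | p.2.2 ∈ Ioo (-ε) ε}

/-- `h` is doubly periodic in `(x,y)` on the strip `ℝ² × (-ε,ε)`. -/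
def DoublyPeriodicOn (ε : ℝ) (h : ℝ × ℝ × ℝ → ℝ) : Prop :=
  ∀ x y t : ℝ, t ∈ Ioo (-ε) ε →
    h (x + 1, y, t) = h (x, y, t) ∧ h (x, y + 1, t) = h (x, y, t)

/-- System (11) of the paper holds at the point `p`. -/
def System11At (Λ u₀ f g : ℝ × ℝ × ℝ → ℝ) (p : ℝ × ℝ × ℝ) : Prop :=
  pT Λ p = g p * pX Λ p + Λ p * pX g p + f p * pY Λ p + Λ p * pY f p ∧
  pT u₀ p = -2 * g p * pX Λ p + g p * pX u₀ p - 2 * Λ p * pX g p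
      + 2 * f p * pY Λ p + f p * pY u₀ p + 2 * Λ p * pY f p ∧
  pT f p = 2 * pY u₀ p ∧
  pT g p = -2 * pX u₀ p

/-- `Λ, u₀, f, g` is a real analytic, doubly periodic in `(x,y)`, solution of the Cauchy
problem for system (11) with Liouville initial data `Λ = Λ₁(x) + Λ₂(y)`,
`u₀ = 2Λ₂(y) - 2Λ₁(x)`, `f = g = 0` at `t = 0`, on the strip `ℝ² × (-ε, ε)`. -/
def IsCauchySolution (Λ₁ Λ₂ : ℝ → ℝ) (ε : ℝ) (Λ u₀ f g : ℝ × ℝ × ℝ → ℝ) : Prop :=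
  AnalyticOnNhd ℝ Λ (Strip ε) ∧ AnalyticOnNhd ℝ u₀ (Strip ε) ∧
  AnalyticOnNhd ℝ f (Strip ε) ∧ AnalyticOnNhd ℝ g (Strip ε) ∧
  DoublyPeriodicOn ε Λ ∧ DoublyPeriodicOn ε u₀ ∧
  DoublyPeriodicOn ε f ∧ DoublyPeriodicOn ε g ∧
  (∀ p ∈ Strip ε, System11At Λ u₀ f g p) ∧
  (∀ x y : ℝ, Λ (x, y, 0) = Λ₁ x + Λ₂ y ∧ u₀ (x, y, 0) = 2 * Λ₂ y - 2 * Λ₁ x ∧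
    f (x, y, 0) = 0 ∧ g (x, y, 0) = 0)


/-- Partial derivative in `x` for a function of two variables. -/
noncomputable def pX2 (h : ℝ × ℝ → ℝ) (p : ℝ × ℝ) : ℝ := fderiv ℝ h p (1, 0)

/-- Partial derivative in `y` for a function of two variables. -/
noncomputable def pY2 (h : ℝ × ℝ → ℝ) (p : ℝ × ℝ) : ℝ := fderiv ℝ h p (0, 1)

/-- System (9) of the paper, for functions `Λ, u₀, f, g : ℝ² → ℝ`. -/
def System9 (Λ u₀ f g : ℝ × ℝ → ℝ) : Prop :=
  ∀ p : ℝ × ℝ,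
    pX2 f p + pY2 g p = 0 ∧
    pX2 (fun q => f q * Λ q) p - pY2 (fun q => g q * Λ q) p = 0 ∧
    pX2 u₀ p + 2 * pX2 Λ p - (1/2) * g p * (pY2 f p - pX2 g p) = 0 ∧
    -(pY2 u₀ p) + 2 * pY2 Λ p + (1/2) * f p * (pY2 f p - pX2 g p) = 0

open scoped Topology

/-- The derivative of `h` in the direction `v`, as a function of the point. -/
noncomputable def dirDeriv (v : ℝ × ℝ × ℝ) (h : ℝ × ℝ × ℝ → ℝ) (p : ℝ × ℝ × ℝ) : ℝ :=
  fderiv ℝ h p v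

theorem pX_eq_dirDeriv : pX = dirDeriv (1, 0, 0) := rfl

theorem pY_eq_dirDeriv : pY = dirDeriv (0, 1, 0) := rfl

theorem pT_eq_dirDeriv : pT = dirDeriv (0, 0, 1) := rfl

section dirDeriv

variable {v w p : ℝ × ℝ × ℝ} {a b : ℝ × ℝ × ℝ → ℝ} {s : Set (ℝ × ℝ × ℝ)}

theorem dirDeriv_add (ha : DifferentiableAt ℝ a p) (hb : DifferentiableAt ℝ b p) :
    dirDeriv v (fun q => a q + b q) p = dirDeriv v a p + dirDeriv v b p := by
  simp [dirDeriv, fderiv_fun_add ha hb]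

theorem dirDeriv_sub (ha : DifferentiableAt ℝ a p) (hb : DifferentiableAt ℝ b p) :
    dirDeriv v (fun q => a q - b q) p = dirDeriv v a p - dirDeriv v b p := by
  simp [dirDeriv, fderiv_fun_sub ha hb]

theorem dirDeriv_neg : dirDeriv v (fun q => -a q) p = -dirDeriv v a p := by
  simp [dirDeriv, fderiv_fun_neg]

theorem dirDeriv_mul (ha : DifferentiableAt ℝ a p) (hb : DifferentiableAt ℝ b p) :
    dirDeriv v (fun q => a q * b q) p = dirDeriv v a p * b p + a p * dirDeriv v b p := by
  simp [dirDeriv, fderiv_fun_mul ha hb]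
  ring

theorem dirDeriv_const_mul (c : ℝ) (ha : DifferentiableAt ℝ a p) :
    dirDeriv v (fun q => c * a q) p = c * dirDeriv v a p := by
  simp [dirDeriv, fderiv_const_mul ha]

theorem dirDeriv_congr (hs : IsOpen s) (hab : EqOn a b s) (hp : p ∈ s) :
    dirDeriv v a p = dirDeriv v b p := by
  have : a =ᶠ[𝓝 p] b := hab.eventuallyEq_of_mem (hs.mem_nhds hp)
  simp [dirDeriv, this.fderiv_eq]

theorem AnalyticOnNhd.dirDeriv (ha : AnalyticOnNhd ℝ a s) (v : ℝ × ℝ × ℝ) :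
    AnalyticOnNhd ℝ (dirDeriv v a) s :=
  (ContinuousLinearMap.apply ℝ ℝ v).comp_analyticOnNhd ha.fderiv

theorem dirDeriv_comm (ha : AnalyticAt ℝ a p) :
    dirDeriv v (dirDeriv w a) p = dirDeriv w (dirDeriv v a) p := by
  have hd : DifferentiableAt ℝ (fderiv ℝ a) p := ha.fderiv.differentiableAt
  have key (v w : ℝ × ℝ × ℝ) :
      dirDeriv v (dirDeriv w a) p = fderiv ℝ (fderiv ℝ a) p v w := by
    have h := hd.hasFDerivAt.clm_apply (hasFDerivAt_const w p)
    change fderiv ℝ (fun q => fderiv ℝ a q w) p v = _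
    simp [h.fderiv]
  rw [key, key]
  exact (ha.contDiffAt (n := 2)).isSymmSndFDerivAt (by simp) v w

end dirDeriv

theorem isOpen_strip (ε : ℝ) : IsOpen (Strip ε) :=
  isOpen_Ioo.preimage (continuous_snd.comp continuous_snd)

theorem zero_time_mem_strip {ε : ℝ} (hε : 0 < ε) (x y : ℝ) :
    ((x, y, 0) : ℝ × ℝ × ℝ) ∈ Strip ε := ⟨by simpa using hε, hε⟩

section slices

variable {h : ℝ × ℝ × ℝ → ℝ} {x y t : ℝ}

theorem hasDerivAt_slice_fst (hh : DifferentiableAt ℝ h (x, y, t)) :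
    HasDerivAt (fun s => h (s, y, t)) (pX h (x, y, t)) x :=
  HasFDerivAt.comp_hasDerivAt (f := fun s : ℝ => (s, y, t)) x hh.hasFDerivAt
    ((hasDerivAt_id x).prodMk (hasDerivAt_const x (y, t)))

theorem hasDerivAt_slice_snd (hh : DifferentiableAt ℝ h (x, y, t)) :
    HasDerivAt (fun s => h (x, s, t)) (pY h (x, y, t)) y :=
  HasFDerivAt.comp_hasDerivAt (f := fun s : ℝ => (x, s, t)) y hh.hasFDerivAt
    ((hasDerivAt_const y x).prodMk ((hasDerivAt_id y).prodMk (hasDerivAt_const y t)))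

theorem hasDerivAt_slice_time (hh : DifferentiableAt ℝ h (x, y, t)) :
    HasDerivAt (fun s => h (x, y, s)) (pT h (x, y, t)) t :=
  HasFDerivAt.comp_hasDerivAt (f := fun s : ℝ => (x, y, s)) t hh.hasFDerivAt
    ((hasDerivAt_const t x).prodMk ((hasDerivAt_const t y).prodMk (hasDerivAt_id t)))

theorem hasFDerivAt_slice (hh : DifferentiableAt ℝ h (x, y, t)) :
    HasFDerivAt (fun q : ℝ × ℝ => h (q.1, q.2, t))
      ((fderiv ℝ h (x, y, t)).comp ((ContinuousLinearMap.fst ℝ ℝ ℝ).prod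
        ((ContinuousLinearMap.snd ℝ ℝ ℝ).prod 0))) (x, y) :=
  HasFDerivAt.comp (f := fun q : ℝ × ℝ => (q.1, q.2, t)) (x, y) hh.hasFDerivAt
    (hasFDerivAt_fst.prodMk (hasFDerivAt_snd.prodMk (hasFDerivAt_const t (x, y))))

theorem pX2_slice (hh : DifferentiableAt ℝ h (x, y, t)) :
    pX2 (fun q => h (q.1, q.2, t)) (x, y) = pX h (x, y, t) := by
  simp [pX2, pX, (hasFDerivAt_slice hh).fderiv]

theorem pY2_slice (hh : DifferentiableAt ℝ h (x, y, t)) :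
    pY2 (fun q => h (q.1, q.2, t)) (x, y) = pY h (x, y, t) := by
  simp [pY2, pY, (hasFDerivAt_slice hh).fderiv]

end slices

/-- The first `n` time derivatives of `h` (from order `0`) vanish identically at `t = 0`. -/
def VanishesToOrder : ℕ → (ℝ × ℝ × ℝ → ℝ) → Prop
  | 0, _ => True
  | n + 1, h => (∀ x y : ℝ, h (x, y, 0) = 0) ∧ VanishesToOrder n (pT h)

/-- `h` is analytic on the strip and vanishes to order `n` in time at `t = 0`. -/
def FlatOn (ε : ℝ) (n : ℕ) (h : ℝ × ℝ × ℝ → ℝ) : Prop :=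
  AnalyticOnNhd ℝ h (Strip ε) ∧ VanishesToOrder n h

section vanishing

variable {ε : ℝ} {n : ℕ} {a b : ℝ × ℝ × ℝ → ℝ}

theorem VanishesToOrder.congr (hε : 0 < ε) (hab : EqOn a b (Strip ε))
    (ha : VanishesToOrder n a) : VanishesToOrder n b := by
  induction n generalizing a b with
  | zero => trivial
  | succ n ih =>
    refine ⟨fun x y => ?_, ih (fun p hp => ?_) ha.2⟩
    · rw [← hab (zero_time_mem_strip hε x y), ha.1]
    · exact dirDeriv_congr (isOpen_strip ε) hab hp

theorem VanishesToOrder.of_succ (ha : VanishesToOrder (n + 1) a) : VanishesToOrder n a := by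
  induction n generalizing a with
  | zero => trivial
  | succ n ih => exact ⟨ha.1, ih ha.2⟩

theorem FlatOn.add (hε : 0 < ε) (ha : FlatOn ε n a) (hb : FlatOn ε n b) :
    FlatOn ε n (fun p => a p + b p) := by
  refine ⟨ha.1.add hb.1, ?_⟩
  induction n generalizing a b with
  | zero => trivial
  | succ n ih =>
    refine ⟨fun x y => by simp [ha.2.1, hb.2.1], ?_⟩
    refine (ih ⟨ha.1.dirDeriv _, ha.2.2⟩ ⟨hb.1.dirDeriv _, hb.2.2⟩).congr hε fun p hp => ?_
    exact (dirDeriv_add (ha.1 p hp).differentiableAt (hb.1 p hp).differentiableAt).symm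

theorem FlatOn.mul_left (hε : 0 < ε) (ha : AnalyticOnNhd ℝ a (Strip ε)) (hb : FlatOn ε n b) :
    FlatOn ε n (fun p => a p * b p) := by
  refine ⟨ha.mul hb.1, ?_⟩
  induction n generalizing a b with
  | zero => trivial
  | succ n ih =>
    refine ⟨fun x y => by simp [hb.2.1], ?_⟩
    have h₁ : FlatOn ε n (fun p => pT a p * b p) :=
      ⟨(ha.dirDeriv _).mul hb.1, ih (ha.dirDeriv _) ⟨hb.1, hb.2.of_succ⟩⟩
    have h₂ : FlatOn ε n (fun p => a p * pT b p) :=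
      ⟨ha.mul (hb.1.dirDeriv _), ih ha ⟨hb.1.dirDeriv _, hb.2.2⟩⟩
    refine (h₁.add hε h₂).2.congr hε fun p hp => ?_
    exact (dirDeriv_mul (ha p hp).differentiableAt (hb.1 p hp).differentiableAt).symm

theorem FlatOn.pX (hε : 0 < ε) (ha : FlatOn ε n a) : FlatOn ε n (pX a) := by
  refine ⟨ha.1.dirDeriv _, ?_⟩
  induction n generalizing a with
  | zero => trivial
  | succ n ih =>
    refine ⟨fun x y => ?_, ?_⟩
    · refine (hasDerivAt_slice_fst
        (ha.1 _ (zero_time_mem_strip hε x y)).differentiableAt).unique ?_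
      simpa [ha.2.1] using hasDerivAt_const x (0 : ℝ)
    · exact (ih ⟨ha.1.dirDeriv _, ha.2.2⟩).congr hε fun p hp => dirDeriv_comm (ha.1 p hp)

theorem FlatOn.pY (hε : 0 < ε) (ha : FlatOn ε n a) : FlatOn ε n (pY a) := by
  refine ⟨ha.1.dirDeriv _, ?_⟩
  induction n generalizing a with
  | zero => trivial
  | succ n ih =>
    refine ⟨fun x y => ?_, ?_⟩
    · refine (hasDerivAt_slice_snd
        (ha.1 _ (zero_time_mem_strip hε x y)).differentiableAt).unique ?_
      simpa [ha.2.1] using hasDerivAt_const y (0 : ℝ)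
    · exact (ih ⟨ha.1.dirDeriv _, ha.2.2⟩).congr hε fun p hp => dirDeriv_comm (ha.1 p hp)

theorem analyticAt_slice_time {x y t : ℝ} (ha : AnalyticOnNhd ℝ a (Strip ε))
    (ht : t ∈ Ioo (-ε) ε) : AnalyticAt ℝ (fun s => a (x, y, s)) t :=
  AnalyticAt.fun_comp (f := fun s : ℝ => (x, y, s)) (ha (x, y, t) ht)
    (analyticAt_const.prod (analyticAt_const.prod analyticAt_id))

theorem FlatOn.le_analyticOrderAt (hε : 0 < ε) (ha : FlatOn ε n a) (x y : ℝ) :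
    (n : ℕ∞) ≤ analyticOrderAt (fun s => a (x, y, s)) 0 := by
  induction n generalizing a with
  | zero => simp
  | succ n ih =>
    have h0 : (0 : ℝ) ∈ Ioo (-ε) ε := zero_time_mem_strip hε x y
    have hd : deriv (fun s => a (x, y, s)) =ᶠ[𝓝 0] fun s => pT a (x, y, s) := by
      filter_upwards [isOpen_Ioo.mem_nhds h0] with s hs
      exact (hasDerivAt_slice_time (ha.1 (x, y, s) hs).differentiableAt).deriv
    have h := (analyticAt_slice_time (x := x) (y := y) ha.1 h0).analyticOrderAt_deriv_add_one
    simp only [ha.2.1, sub_zero, analyticOrderAt_congr hd] at h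
    rw [← h]
    push_cast
    gcongr
    exact ih ⟨ha.1.dirDeriv _, ha.2.2⟩

theorem eqOn_zero_of_forall_flatOn (hε : 0 < ε) (ha : ∀ n, FlatOn ε n a) :
    EqOn a 0 (Strip ε) := by
  rintro ⟨x, y, t⟩ ht
  have htop : analyticOrderAt (fun s => a (x, y, s)) 0 = ⊤ :=
    ENat.eq_top_iff_forall_ge.2 fun n => (ha n).le_analyticOrderAt hε x y
  have hs : AnalyticOnNhd ℝ (fun s => a (x, y, s)) (Ioo (-ε) ε) :=
    fun s hs => analyticAt_slice_time (ha 0).1 hs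
  exact hs.eqOn_zero_of_preconnected_of_eventuallyEq_zero isPreconnected_Ioo
    (zero_time_mem_strip hε x y) (analyticOrderAt_eq_top.1 htop) ht

end vanishing

/-- The left-hand side of the first equation of system (9). -/
noncomputable def defect₁ (f g : ℝ × ℝ × ℝ → ℝ) (p : ℝ × ℝ × ℝ) : ℝ :=
  pX f p + pY g p

/-- The left-hand side of the second equation of system (9). -/
noncomputable def defect₂ (Λ f g : ℝ × ℝ × ℝ → ℝ) (p : ℝ × ℝ × ℝ) : ℝ :=
  (pX f p * Λ p + f p * pX Λ p) - (pY g p * Λ p + g p * pY Λ p)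

/-- The left-hand side of the third equation of system (9). -/
noncomputable def defect₃ (Λ u₀ f g : ℝ × ℝ × ℝ → ℝ) (p : ℝ × ℝ × ℝ) : ℝ :=
  pX u₀ p + 2 * pX Λ p - (1/2) * (g p * (pY f p - pX g p))

/-- The left-hand side of the fourth equation of system (9). -/
noncomputable def defect₄ (Λ u₀ f g : ℝ × ℝ × ℝ → ℝ) (p : ℝ × ℝ × ℝ) : ℝ :=
  -pY u₀ p + 2 * pY Λ p + (1/2) * (f p * (pY f p - pX g p))

section defects

variable {s : Set (ℝ × ℝ × ℝ)} {Λ u₀ f g : ℝ × ℝ × ℝ → ℝ} {p : ℝ × ℝ × ℝ}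

theorem analyticOnNhd_defect₁ (hf : AnalyticOnNhd ℝ f s) (hg : AnalyticOnNhd ℝ g s) :
    AnalyticOnNhd ℝ (defect₁ f g) s :=
  (hf.dirDeriv _).add (hg.dirDeriv _)

theorem analyticOnNhd_defect₂ (hΛ : AnalyticOnNhd ℝ Λ s) (hf : AnalyticOnNhd ℝ f s)
    (hg : AnalyticOnNhd ℝ g s) : AnalyticOnNhd ℝ (defect₂ Λ f g) s :=
  (((hf.dirDeriv _).mul hΛ).add (hf.mul (hΛ.dirDeriv _))).sub
    (((hg.dirDeriv _).mul hΛ).add (hg.mul (hΛ.dirDeriv _)))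

theorem analyticOnNhd_defect₃ (hΛ : AnalyticOnNhd ℝ Λ s) (hu : AnalyticOnNhd ℝ u₀ s)
    (hf : AnalyticOnNhd ℝ f s) (hg : AnalyticOnNhd ℝ g s) :
    AnalyticOnNhd ℝ (defect₃ Λ u₀ f g) s :=
  ((hu.dirDeriv _).add (analyticOnNhd_const.mul (hΛ.dirDeriv _))).sub
    (analyticOnNhd_const.mul (hg.mul ((hf.dirDeriv _).sub (hg.dirDeriv _))))

theorem analyticOnNhd_defect₄ (hΛ : AnalyticOnNhd ℝ Λ s) (hu : AnalyticOnNhd ℝ u₀ s)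
    (hf : AnalyticOnNhd ℝ f s) (hg : AnalyticOnNhd ℝ g s) :
    AnalyticOnNhd ℝ (defect₄ Λ u₀ f g) s :=
  ((hu.dirDeriv _).neg.add (analyticOnNhd_const.mul (hΛ.dirDeriv _))).add
    (analyticOnNhd_const.mul (hf.mul ((hf.dirDeriv _).sub (hg.dirDeriv _))))

theorem dirDeriv_defect₁ (hf : AnalyticOnNhd ℝ f s) (hg : AnalyticOnNhd ℝ g s) (hp : p ∈ s)
    (v : ℝ × ℝ × ℝ) :
    dirDeriv v (defect₁ f g) p = dirDeriv v (pX f) p + dirDeriv v (pY g) p :=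
  dirDeriv_add (hf.dirDeriv _ p hp).differentiableAt (hg.dirDeriv _ p hp).differentiableAt

theorem dirDeriv_defect₂ (hΛ : AnalyticOnNhd ℝ Λ s) (hf : AnalyticOnNhd ℝ f s)
    (hg : AnalyticOnNhd ℝ g s) (hp : p ∈ s) (v : ℝ × ℝ × ℝ) :
    dirDeriv v (defect₂ Λ f g) p =
      dirDeriv v (pX f) p * Λ p + pX f p * dirDeriv v Λ p
        + (dirDeriv v f p * pX Λ p + f p * dirDeriv v (pX Λ) p)
        - (dirDeriv v (pY g) p * Λ p + pY g p * dirDeriv v Λ p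
        + (dirDeriv v g p * pY Λ p + g p * dirDeriv v (pY Λ) p)) := by
  have dΛ := (hΛ p hp).differentiableAt
  have df := (hf p hp).differentiableAt
  have dg := (hg p hp).differentiableAt
  have dΛx : DifferentiableAt ℝ (pX Λ) p := (hΛ.dirDeriv _ p hp).differentiableAt
  have dΛy : DifferentiableAt ℝ (pY Λ) p := (hΛ.dirDeriv _ p hp).differentiableAt
  have dfx : DifferentiableAt ℝ (pX f) p := (hf.dirDeriv _ p hp).differentiableAt
  have dgy : DifferentiableAt ℝ (pY g) p := (hg.dirDeriv _ p hp).differentiableAt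
  unfold defect₂
  rw [dirDeriv_sub (by fun_prop) (by fun_prop), dirDeriv_add (by fun_prop) (by fun_prop),
    dirDeriv_add (by fun_prop) (by fun_prop), dirDeriv_mul dfx dΛ, dirDeriv_mul df dΛx,
    dirDeriv_mul dgy dΛ, dirDeriv_mul dg dΛy]

theorem dirDeriv_defect₃ (hΛ : AnalyticOnNhd ℝ Λ s) (hu : AnalyticOnNhd ℝ u₀ s)
    (hf : AnalyticOnNhd ℝ f s) (hg : AnalyticOnNhd ℝ g s) (hp : p ∈ s) (v : ℝ × ℝ × ℝ) :
    dirDeriv v (defect₃ Λ u₀ f g) p =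
      dirDeriv v (pX u₀) p + 2 * dirDeriv v (pX Λ) p
        - (1/2) * (dirDeriv v g p * (pY f p - pX g p)
        + g p * (dirDeriv v (pY f) p - dirDeriv v (pX g) p)) := by
  have dg := (hg p hp).differentiableAt
  have dΛx : DifferentiableAt ℝ (pX Λ) p := (hΛ.dirDeriv _ p hp).differentiableAt
  have dux : DifferentiableAt ℝ (pX u₀) p := (hu.dirDeriv _ p hp).differentiableAt
  have dfy : DifferentiableAt ℝ (pY f) p := (hf.dirDeriv _ p hp).differentiableAt
  have dgx : DifferentiableAt ℝ (pX g) p := (hg.dirDeriv _ p hp).differentiableAt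
  unfold defect₃
  rw [dirDeriv_sub (by fun_prop) (by fun_prop), dirDeriv_add (by fun_prop) (by fun_prop),
    dirDeriv_const_mul _ dΛx, dirDeriv_const_mul _ (by fun_prop),
    dirDeriv_mul dg (by fun_prop), dirDeriv_sub dfy dgx]

theorem dirDeriv_defect₄ (hΛ : AnalyticOnNhd ℝ Λ s) (hu : AnalyticOnNhd ℝ u₀ s)
    (hf : AnalyticOnNhd ℝ f s) (hg : AnalyticOnNhd ℝ g s) (hp : p ∈ s) (v : ℝ × ℝ × ℝ) :
    dirDeriv v (defect₄ Λ u₀ f g) p =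
      -dirDeriv v (pY u₀) p + 2 * dirDeriv v (pY Λ) p
        + (1/2) * (dirDeriv v f p * (pY f p - pX g p)
        + f p * (dirDeriv v (pY f) p - dirDeriv v (pX g) p)) := by
  have df := (hf p hp).differentiableAt
  have dΛy : DifferentiableAt ℝ (pY Λ) p := (hΛ.dirDeriv _ p hp).differentiableAt
  have duy : DifferentiableAt ℝ (pY u₀) p := (hu.dirDeriv _ p hp).differentiableAt
  have dfy : DifferentiableAt ℝ (pY f) p := (hf.dirDeriv _ p hp).differentiableAt
  have dgx : DifferentiableAt ℝ (pX g) p := (hg.dirDeriv _ p hp).differentiableAt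
  unfold defect₄
  rw [dirDeriv_add (by fun_prop) (by fun_prop), dirDeriv_add (by fun_prop) (by fun_prop),
    dirDeriv_neg, dirDeriv_const_mul _ dΛy, dirDeriv_const_mul _ (by fun_prop),
    dirDeriv_mul df (by fun_prop), dirDeriv_sub dfy dgx]

end defects

section evolution

variable {s : Set (ℝ × ℝ × ℝ)} {Λ u₀ f g : ℝ × ℝ × ℝ → ℝ} {p : ℝ × ℝ × ℝ}

theorem dirDeriv_pT_f (hs : IsOpen s) (hu : AnalyticOnNhd ℝ u₀ s)
    (h : ∀ p ∈ s, System11At Λ u₀ f g p) (hp : p ∈ s) (v : ℝ × ℝ × ℝ) :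
    dirDeriv v (pT f) p = 2 * dirDeriv v (pY u₀) p := by
  rw [dirDeriv_congr (b := fun q => 2 * pY u₀ q) hs (fun q hq => (h q hq).2.2.1) hp]
  exact dirDeriv_const_mul _ (hu.dirDeriv _ p hp).differentiableAt

theorem dirDeriv_pT_g (hs : IsOpen s) (hu : AnalyticOnNhd ℝ u₀ s)
    (h : ∀ p ∈ s, System11At Λ u₀ f g p) (hp : p ∈ s) (v : ℝ × ℝ × ℝ) :
    dirDeriv v (pT g) p = -2 * dirDeriv v (pX u₀) p := by
  rw [dirDeriv_congr (b := fun q => -2 * pX u₀ q) hs (fun q hq => (h q hq).2.2.2) hp]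
  exact dirDeriv_const_mul _ (hu.dirDeriv _ p hp).differentiableAt

theorem dirDeriv_pT_Λ (hs : IsOpen s) (hΛ : AnalyticOnNhd ℝ Λ s) (hf : AnalyticOnNhd ℝ f s)
    (hg : AnalyticOnNhd ℝ g s) (h : ∀ p ∈ s, System11At Λ u₀ f g p) (hp : p ∈ s)
    (v : ℝ × ℝ × ℝ) :
    dirDeriv v (pT Λ) p =
      dirDeriv v g p * pX Λ p + g p * dirDeriv v (pX Λ) p
        + (dirDeriv v Λ p * pX g p + Λ p * dirDeriv v (pX g) p)
        + (dirDeriv v f p * pY Λ p + f p * dirDeriv v (pY Λ) p)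
        + (dirDeriv v Λ p * pY f p + Λ p * dirDeriv v (pY f) p) := by
  have dΛ := (hΛ p hp).differentiableAt
  have df := (hf p hp).differentiableAt
  have dg := (hg p hp).differentiableAt
  have dΛx : DifferentiableAt ℝ (pX Λ) p := (hΛ.dirDeriv _ p hp).differentiableAt
  have dΛy : DifferentiableAt ℝ (pY Λ) p := (hΛ.dirDeriv _ p hp).differentiableAt
  have dfy : DifferentiableAt ℝ (pY f) p := (hf.dirDeriv _ p hp).differentiableAt
  have dgx : DifferentiableAt ℝ (pX g) p := (hg.dirDeriv _ p hp).differentiableAt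
  rw [dirDeriv_congr hs (fun q hq => (h q hq).1) hp,
    dirDeriv_add (by fun_prop) (by fun_prop), dirDeriv_add (by fun_prop) (by fun_prop),
    dirDeriv_add (by fun_prop) (by fun_prop), dirDeriv_mul dg dΛx, dirDeriv_mul dΛ dgx,
    dirDeriv_mul df dΛy, dirDeriv_mul dΛ dfy]

theorem dirDeriv_pT_u₀ (hs : IsOpen s) (hΛ : AnalyticOnNhd ℝ Λ s) (hu : AnalyticOnNhd ℝ u₀ s)
    (hf : AnalyticOnNhd ℝ f s) (hg : AnalyticOnNhd ℝ g s)
    (h : ∀ p ∈ s, System11At Λ u₀ f g p) (hp : p ∈ s) (v : ℝ × ℝ × ℝ) :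
    dirDeriv v (pT u₀) p =
      -2 * (dirDeriv v g p * pX Λ p + g p * dirDeriv v (pX Λ) p)
        + (dirDeriv v g p * pX u₀ p + g p * dirDeriv v (pX u₀) p)
        - 2 * (dirDeriv v Λ p * pX g p + Λ p * dirDeriv v (pX g) p)
        + 2 * (dirDeriv v f p * pY Λ p + f p * dirDeriv v (pY Λ) p)
        + (dirDeriv v f p * pY u₀ p + f p * dirDeriv v (pY u₀) p)
        + 2 * (dirDeriv v Λ p * pY f p + Λ p * dirDeriv v (pY f) p) := by
  have dΛ := (hΛ p hp).differentiableAt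
  have df := (hf p hp).differentiableAt
  have dg := (hg p hp).differentiableAt
  have dΛx : DifferentiableAt ℝ (pX Λ) p := (hΛ.dirDeriv _ p hp).differentiableAt
  have dΛy : DifferentiableAt ℝ (pY Λ) p := (hΛ.dirDeriv _ p hp).differentiableAt
  have dux : DifferentiableAt ℝ (pX u₀) p := (hu.dirDeriv _ p hp).differentiableAt
  have duy : DifferentiableAt ℝ (pY u₀) p := (hu.dirDeriv _ p hp).differentiableAt
  have dfy : DifferentiableAt ℝ (pY f) p := (hf.dirDeriv _ p hp).differentiableAt
  have dgx : DifferentiableAt ℝ (pX g) p := (hg.dirDeriv _ p hp).differentiableAt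
  have e : EqOn (pT u₀) (fun p => -2 * (g p * pX Λ p) + g p * pX u₀ p - 2 * (Λ p * pX g p)
      + 2 * (f p * pY Λ p) + f p * pY u₀ p + 2 * (Λ p * pY f p)) s := fun q hq => by
    dsimp only
    rw [(h q hq).2.1]
    ring
  rw [dirDeriv_congr hs e hp,
    dirDeriv_add (by fun_prop) (by fun_prop), dirDeriv_add (by fun_prop) (by fun_prop),
    dirDeriv_add (by fun_prop) (by fun_prop), dirDeriv_sub (by fun_prop) (by fun_prop),
    dirDeriv_add (by fun_prop) (by fun_prop), dirDeriv_const_mul _ (by fun_prop),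
    dirDeriv_const_mul _ (by fun_prop), dirDeriv_const_mul _ (by fun_prop),
    dirDeriv_const_mul _ (by fun_prop), dirDeriv_mul dg dΛx, dirDeriv_mul dΛ dgx,
    dirDeriv_mul df dΛy, dirDeriv_mul dΛ dfy, dirDeriv_mul dg dux, dirDeriv_mul df duy]

theorem pT_defect₁ (hs : IsOpen s) (hu : AnalyticOnNhd ℝ u₀ s)
    (hf : AnalyticOnNhd ℝ f s) (hg : AnalyticOnNhd ℝ g s)
    (h : ∀ p ∈ s, System11At Λ u₀ f g p) (hp : p ∈ s) :
    pT (defect₁ f g) p = 0 := by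
  have hfT := dirDeriv_pT_f hs hu h hp
  have hgT := dirDeriv_pT_g hs hu h hp
  simp only [pT_eq_dirDeriv, pX_eq_dirDeriv, pY_eq_dirDeriv, dirDeriv_defect₁ hf hg hp]
    at hfT hgT ⊢
  rw [dirDeriv_comm (hf p hp), dirDeriv_comm (hg p hp), hfT, hgT,
    dirDeriv_comm (v := (0, 1, 0)) (hu p hp)]
  ring

theorem pT_defect₂ (hs : IsOpen s) (hΛ : AnalyticOnNhd ℝ Λ s) (hu : AnalyticOnNhd ℝ u₀ s)
    (hf : AnalyticOnNhd ℝ f s) (hg : AnalyticOnNhd ℝ g s)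
    (h : ∀ p ∈ s, System11At Λ u₀ f g p) (hp : p ∈ s) :
    pT (defect₂ Λ f g) p =
      -(Λ p * g p) * pX (defect₁ f g) p + Λ p * f p * pY (defect₁ f g) p
        + (Λ p * pY f p - Λ p * pX g p + f p * pY Λ p - g p * pX Λ p) * defect₁ f g p
        + g p * pX (defect₂ Λ f g) p + f p * pY (defect₂ Λ f g) p
        + (pY f p + pX g p) * defect₂ Λ f g p
        + 2 * Λ p * pY (defect₃ Λ u₀ f g) p + 2 * pY Λ p * defect₃ Λ u₀ f g p
        + -2 * Λ p * pX (defect₄ Λ u₀ f g) p + -2 * pX Λ p * defect₄ Λ u₀ f g p := by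
  have hfT := dirDeriv_pT_f hs hu h hp
  have hgT := dirDeriv_pT_g hs hu h hp
  have hΛT := dirDeriv_pT_Λ hs hΛ hf hg h hp
  obtain ⟨eΛ, -, ef, eg⟩ := h p hp
  simp only [pT_eq_dirDeriv, pX_eq_dirDeriv, pY_eq_dirDeriv, dirDeriv_defect₁ hf hg hp,
    dirDeriv_defect₂ hΛ hf hg hp, dirDeriv_defect₃ hΛ hu hf hg hp,
    dirDeriv_defect₄ hΛ hu hf hg hp, defect₁, defect₂, defect₃, defect₄]
    at hfT hgT hΛT eΛ ef eg ⊢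
  simp only [dirDeriv_comm (v := (0, 0, 1)) (hf p hp), dirDeriv_comm (v := (0, 0, 1)) (hg p hp),
    dirDeriv_comm (v := (0, 0, 1)) (hΛ p hp), hfT, hgT, hΛT, eΛ, ef, eg,
    dirDeriv_comm (v := (0, 1, 0)) (w := (1, 0, 0)) (hΛ p hp),
    dirDeriv_comm (v := (0, 1, 0)) (w := (1, 0, 0)) (hu p hp),
    dirDeriv_comm (v := (0, 1, 0)) (w := (1, 0, 0)) (hf p hp),
    dirDeriv_comm (v := (0, 1, 0)) (w := (1, 0, 0)) (hg p hp)]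
  ring

theorem pT_defect₃ (hs : IsOpen s) (hΛ : AnalyticOnNhd ℝ Λ s) (hu : AnalyticOnNhd ℝ u₀ s)
    (hf : AnalyticOnNhd ℝ f s) (hg : AnalyticOnNhd ℝ g s)
    (h : ∀ p ∈ s, System11At Λ u₀ f g p) (hp : p ∈ s) :
    pT (defect₃ Λ u₀ f g) p =
      2 * Λ p * pY (defect₁ f g) p
        + (4 * pY Λ p + (1/2) * f p * pY f p - (1/2) * f p * pX g p) * defect₁ f g p
        + 2 * pY (defect₂ Λ f g) p
        + f p * pY (defect₃ Λ u₀ f g) p + pY f p * defect₃ Λ u₀ f g p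
        + g p * pY (defect₄ Λ u₀ f g) p + -pX f p * defect₄ Λ u₀ f g p := by
  have hfT := dirDeriv_pT_f hs hu h hp
  have hgT := dirDeriv_pT_g hs hu h hp
  have hΛT := dirDeriv_pT_Λ hs hΛ hf hg h hp
  have huT := dirDeriv_pT_u₀ hs hΛ hu hf hg h hp
  obtain ⟨-, -, -, eg⟩ := h p hp
  simp only [pT_eq_dirDeriv, pX_eq_dirDeriv, pY_eq_dirDeriv, dirDeriv_defect₁ hf hg hp,
    dirDeriv_defect₂ hΛ hf hg hp, dirDeriv_defect₃ hΛ hu hf hg hp,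
    dirDeriv_defect₄ hΛ hu hf hg hp, defect₁, defect₃, defect₄]
    at hfT hgT hΛT huT eg ⊢
  simp only [dirDeriv_comm (v := (0, 0, 1)) (hf p hp), dirDeriv_comm (v := (0, 0, 1)) (hg p hp),
    dirDeriv_comm (v := (0, 0, 1)) (hΛ p hp), dirDeriv_comm (v := (0, 0, 1)) (hu p hp),
    hfT, hgT, hΛT, huT, eg,
    dirDeriv_comm (v := (0, 1, 0)) (w := (1, 0, 0)) (hΛ p hp),
    dirDeriv_comm (v := (0, 1, 0)) (w := (1, 0, 0)) (hu p hp),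
    dirDeriv_comm (v := (0, 1, 0)) (w := (1, 0, 0)) (hf p hp),
    dirDeriv_comm (v := (0, 1, 0)) (w := (1, 0, 0)) (hg p hp)]
  ring

theorem pT_defect₄ (hs : IsOpen s) (hΛ : AnalyticOnNhd ℝ Λ s) (hu : AnalyticOnNhd ℝ u₀ s)
    (hf : AnalyticOnNhd ℝ f s) (hg : AnalyticOnNhd ℝ g s)
    (h : ∀ p ∈ s, System11At Λ u₀ f g p) (hp : p ∈ s) :
    pT (defect₄ Λ u₀ f g) p =
      2 * Λ p * pX (defect₁ f g) p + (2 * pX Λ p - pX u₀ p) * defect₁ f g p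
        + -2 * pX (defect₂ Λ f g) p
        + f p * pX (defect₃ Λ u₀ f g) p + pX f p * defect₃ Λ u₀ f g p
        + g p * pX (defect₄ Λ u₀ f g) p + pX g p * defect₄ Λ u₀ f g p := by
  have hfT := dirDeriv_pT_f hs hu h hp
  have hgT := dirDeriv_pT_g hs hu h hp
  have hΛT := dirDeriv_pT_Λ hs hΛ hf hg h hp
  have huT := dirDeriv_pT_u₀ hs hΛ hu hf hg h hp
  obtain ⟨-, -, ef, -⟩ := h p hp
  simp only [pT_eq_dirDeriv, pX_eq_dirDeriv, pY_eq_dirDeriv, dirDeriv_defect₁ hf hg hp,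
    dirDeriv_defect₂ hΛ hf hg hp, dirDeriv_defect₃ hΛ hu hf hg hp,
    dirDeriv_defect₄ hΛ hu hf hg hp, defect₁, defect₃, defect₄]
    at hfT hgT hΛT huT ef ⊢
  simp only [dirDeriv_comm (v := (0, 0, 1)) (hf p hp), dirDeriv_comm (v := (0, 0, 1)) (hg p hp),
    dirDeriv_comm (v := (0, 0, 1)) (hΛ p hp), dirDeriv_comm (v := (0, 0, 1)) (hu p hp),
    hfT, hgT, hΛT, huT, ef,
    dirDeriv_comm (v := (0, 1, 0)) (w := (1, 0, 0)) (hΛ p hp),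
    dirDeriv_comm (v := (0, 1, 0)) (w := (1, 0, 0)) (hu p hp),
    dirDeriv_comm (v := (0, 1, 0)) (w := (1, 0, 0)) (hg p hp)]
  ring

end evolution

/-- If the four defects vanish at `t = 0`, they vanish to infinite order there. -/
theorem flatOn_defects {ε : ℝ} (hε : 0 < ε) {Λ u₀ f g : ℝ × ℝ × ℝ → ℝ}
    (hΛ : AnalyticOnNhd ℝ Λ (Strip ε)) (hu : AnalyticOnNhd ℝ u₀ (Strip ε))
    (hf : AnalyticOnNhd ℝ f (Strip ε)) (hg : AnalyticOnNhd ℝ g (Strip ε))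
    (h : ∀ p ∈ Strip ε, System11At Λ u₀ f g p)
    (h₁ : ∀ x y : ℝ, defect₁ f g (x, y, 0) = 0)
    (h₂ : ∀ x y : ℝ, defect₂ Λ f g (x, y, 0) = 0)
    (h₃ : ∀ x y : ℝ, defect₃ Λ u₀ f g (x, y, 0) = 0)
    (h₄ : ∀ x y : ℝ, defect₄ Λ u₀ f g (x, y, 0) = 0) (n : ℕ) :
    FlatOn ε n (defect₁ f g) ∧ FlatOn ε n (defect₂ Λ f g) ∧
      FlatOn ε n (defect₃ Λ u₀ f g) ∧ FlatOn ε n (defect₄ Λ u₀ f g) := by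
  have hs := isOpen_strip ε
  have a₁ := analyticOnNhd_defect₁ hf hg
  have a₂ := analyticOnNhd_defect₂ hΛ hf hg
  have a₃ := analyticOnNhd_defect₃ hΛ hu hf hg
  have a₄ := analyticOnNhd_defect₄ hΛ hu hf hg
  have hX {a : ℝ × ℝ × ℝ → ℝ} (ha : AnalyticOnNhd ℝ a (Strip ε)) :
      AnalyticOnNhd ℝ (pX a) (Strip ε) := ha.dirDeriv _
  have hY {a : ℝ × ℝ × ℝ → ℝ} (ha : AnalyticOnNhd ℝ a (Strip ε)) :
      AnalyticOnNhd ℝ (pY a) (Strip ε) := ha.dirDeriv _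
  have c (r : ℝ) : AnalyticOnNhd ℝ (fun _ : ℝ × ℝ × ℝ => r) (Strip ε) := analyticOnNhd_const
  induction n with
  | zero => exact ⟨⟨a₁, trivial⟩, ⟨a₂, trivial⟩, ⟨a₃, trivial⟩, ⟨a₄, trivial⟩⟩
  | succ n ih =>
    obtain ⟨i₁, i₂, i₃, i₄⟩ := ih
    refine ⟨⟨a₁, h₁, ?_⟩, ⟨a₂, h₂, ?_⟩, ⟨a₃, h₃, ?_⟩, ⟨a₄, h₄, ?_⟩⟩
    · refine (FlatOn.mul_left hε (c 0) i₁).2.congr hε fun p hp => ?_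
      simp [pT_defect₁ hs hu hf hg h hp]
    · refine VanishesToOrder.congr hε
        (fun p hp => (pT_defect₂ hs hΛ hu hf hg h hp).symm) (FlatOn.add hε ?_ ?_).2
      repeat' apply FlatOn.add hε
      · exact (i₁.pX hε).mul_left hε (hΛ.mul hg).neg
      · exact (i₁.pY hε).mul_left hε (hΛ.mul hf)
      · exact i₁.mul_left hε ((((hΛ.mul (hY hf)).sub (hΛ.mul (hX hg))).add
          (hf.mul (hY hΛ))).sub (hg.mul (hX hΛ)))
      · exact (i₂.pX hε).mul_left hε hg
      · exact (i₂.pY hε).mul_left hε hf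
      · exact i₂.mul_left hε ((hY hf).add (hX hg))
      · exact (i₃.pY hε).mul_left hε ((c 2).mul hΛ)
      · exact i₃.mul_left hε ((c 2).mul (hY hΛ))
      · exact (i₄.pX hε).mul_left hε ((c (-2)).mul hΛ)
      · exact i₄.mul_left hε ((c (-2)).mul (hX hΛ))
    · refine VanishesToOrder.congr hε
        (fun p hp => (pT_defect₃ hs hΛ hu hf hg h hp).symm) (FlatOn.add hε ?_ ?_).2
      repeat' apply FlatOn.add hε
      · exact (i₁.pY hε).mul_left hε ((c 2).mul hΛ)
      · exact i₁.mul_left hε ((((c 4).mul (hY hΛ)).add (((c (1/2)).mul hf).mul (hY hf))).sub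
          (((c (1/2)).mul hf).mul (hX hg)))
      · exact (i₂.pY hε).mul_left hε (c 2)
      · exact (i₃.pY hε).mul_left hε hf
      · exact i₃.mul_left hε (hY hf)
      · exact (i₄.pY hε).mul_left hε hg
      · exact i₄.mul_left hε (hX hf).neg
    · refine VanishesToOrder.congr hε
        (fun p hp => (pT_defect₄ hs hΛ hu hf hg h hp).symm) (FlatOn.add hε ?_ ?_).2
      repeat' apply FlatOn.add hε
      · exact (i₁.pX hε).mul_left hε ((c 2).mul hΛ)
      · exact i₁.mul_left hε (((c 2).mul (hX hΛ)).sub (hX hu))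
      · exact (i₂.pX hε).mul_left hε (c (-2))
      · exact (i₃.pX hε).mul_left hε hf
      · exact i₃.mul_left hε (hX hf)
      · exact (i₄.pX hε).mul_left hε hg
      · exact i₄.mul_left hε (hX hg)

/-- The flow of system (11) preserves the set of solutions of system (9):
if `Λ, u₀, f, g` is the real analytic, doubly periodic in `(x,y)`, solution of system (11)
with Liouville initial data (`Λ₁` nonconstant), then for every fixed `t ∈ (-ε, ε)` the slice
functions `(x,y) ↦ Λ(x,y,t)`, etc., satisfy system (9). -/
theorem statement4
    (Λ₁ Λ₂ : ℝ → ℝ)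
    (hΛ₁a : AnalyticOnNhd ℝ Λ₁ univ) (hΛ₂a : AnalyticOnNhd ℝ Λ₂ univ)
    (hΛ₁pos : ∀ x, 0 < Λ₁ x) (hΛ₂pos : ∀ y, 0 < Λ₂ y)
    (hΛ₁per : Function.Periodic Λ₁ 1) (hΛ₂per : Function.Periodic Λ₂ 1)
    (hΛ₁nc : ∃ a b : ℝ, Λ₁ a ≠ Λ₁ b)
    (ε : ℝ) (hε : 0 < ε)
    (Λ u₀ f g : ℝ × ℝ × ℝ → ℝ)
    (hsol : IsCauchySolution Λ₁ Λ₂ ε Λ u₀ f g) :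
    ∀ t ∈ Ioo (-ε) ε,
      System9 (fun q => Λ (q.1, q.2, t)) (fun q => u₀ (q.1, q.2, t))
        (fun q => f (q.1, q.2, t)) (fun q => g (q.1, q.2, t)) := by
  obtain ⟨hΛ, hu, hf, hg, -, -, -, -, hsys, hinit⟩ := hsol
  have dslice {h : ℝ × ℝ × ℝ → ℝ} (hh : AnalyticOnNhd ℝ h (Strip ε)) (x y : ℝ) :
      DifferentiableAt ℝ h (x, y, 0) := (hh _ (zero_time_mem_strip hε x y)).differentiableAt
  have hΛx (x y : ℝ) : pX Λ (x, y, 0) = deriv Λ₁ x := by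
    rw [← (hasDerivAt_slice_fst (dslice hΛ x y)).deriv]
    simp [(hinit _ _).1]
  have hΛy (x y : ℝ) : pY Λ (x, y, 0) = deriv Λ₂ y := by
    rw [← (hasDerivAt_slice_snd (dslice hΛ x y)).deriv]
    simp [(hinit _ _).1]
  have hux (x y : ℝ) : pX u₀ (x, y, 0) = -(2 * deriv Λ₁ x) := by
    rw [← (hasDerivAt_slice_fst (dslice hu x y)).deriv]
    simp [(hinit _ _).2.1]
  have huy (x y : ℝ) : pY u₀ (x, y, 0) = 2 * deriv Λ₂ y := by
    rw [← (hasDerivAt_slice_snd (dslice hu x y)).deriv]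
    simp [(hinit _ _).2.1]
  have hf0 (x y : ℝ) : f (x, y, 0) = 0 := (hinit x y).2.2.1
  have hg0 (x y : ℝ) : g (x, y, 0) = 0 := (hinit x y).2.2.2
  have hfx (x y : ℝ) : pX f (x, y, 0) = 0 := by
    rw [← (hasDerivAt_slice_fst (dslice hf x y)).deriv]
    simp [hf0]
  have hgy (x y : ℝ) : pY g (x, y, 0) = 0 := by
    rw [← (hasDerivAt_slice_snd (dslice hg x y)).deriv]
    simp [hg0]
  have flat := flatOn_defects hε hΛ hu hf hg hsys
    (fun x y => by simp [defect₁, hfx, hgy])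
    (fun x y => by simp [defect₂, hfx, hgy, hf0, hg0])
    (fun x y => by simp [defect₃, hux, hΛx, hg0])
    (fun x y => by simp [defect₄, huy, hΛy, hf0])
  rintro t ht ⟨x, y⟩
  have hp : ((x, y, t) : ℝ × ℝ × ℝ) ∈ Strip ε := ht
  have z₁ := eqOn_zero_of_forall_flatOn hε (fun n => (flat n).1) hp
  have z₂ := eqOn_zero_of_forall_flatOn hε (fun n => (flat n).2.1) hp
  have z₃ := eqOn_zero_of_forall_flatOn hε (fun n => (flat n).2.2.1) hp
  have z₄ := eqOn_zero_of_forall_flatOn hε (fun n => (flat n).2.2.2) hp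
  simp only [defect₁, defect₂, defect₃, defect₄, Pi.zero_apply] at z₁ z₂ z₃ z₄
  have dΛ := (hΛ _ hp).differentiableAt
  have du := (hu _ hp).differentiableAt
  have df := (hf _ hp).differentiableAt
  have dg := (hg _ hp).differentiableAt
  have efΛ : pX (fun q => f q * Λ q) (x, y, t) = _ := dirDeriv_mul df dΛ
  have egΛ : pY (fun q => g q * Λ q) (x, y, t) = _ := dirDeriv_mul dg dΛ
  rw [pX2_slice df, pY2_slice dg, pX2_slice (h := fun q => f q * Λ q) (df.fun_mul dΛ),
    pY2_slice (h := fun q => g q * Λ q) (dg.fun_mul dΛ), pX2_slice du, pX2_slice dΛ,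
    pY2_slice df, pX2_slice dg, pY2_slice du, pY2_slice dΛ, efΛ, egΛ]
  exact ⟨z₁, z₂, by linear_combination z₃, by linear_combination z₄⟩
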